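/- (Corollary 2) Let N ≥ 1 and 0 < α < 1. Let ψ be a fully product N-qubit pure state ψ(x) = ∏_i φ_i(x i) in which each single-qubit factor is an equal-weight superposition, i.e., |φ_i(0)|² = |φ_i(1)|² = 1/2 for all i (for example φ_i = (|0⟩ + e^{iϕ_i}|1⟩)/√2 for arbitrary phases ϕ_i). Then E_ψ[Z_i] = 0 for all i, the QFIM of ψ equals F(ψ) = 4·I, and Tr(W̄·F(ψ)⁻¹) = N·a/4 = 4N[(N−1)α² + 1]; thus these states attain the optimal precision over pure product probes. -/

import Mathlib

open scoped BigOperators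

/-- Sign of a qubit basis label: `ε(0) = 1`, `ε(1) = −1`. -/
def qubitSign : Fin 2 → ℝ := fun b => if b = 0 then 1 else -1

/-- Pauli-z expectation `E_ψ[Z_i] = Σ_x ε(x i) |ψ x|²` of an `N`-qubit state. -/
noncomputable def expZ {N : ℕ} (ψ : (Fin N → Fin 2) → ℂ) (i : Fin N) : ℝ :=
  ∑ x : Fin N → Fin 2, qubitSign (x i) * ‖ψ x‖ ^ 2

/-- Pauli-z correlator `E_ψ[Z_i Z_j] = Σ_x ε(x i) ε(x j) |ψ x|²`. -/
noncomputable def expZZ {N : ℕ} (ψ : (Fin N → Fin 2) → ℂ) (i j : Fin N) : ℝ :=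
  ∑ x : Fin N → Fin 2, qubitSign (x i) * qubitSign (x j) * ‖ψ x‖ ^ 2

/-- Quantum Fisher information matrix of the pure probe `ψ` for estimating the `N`
independent field strengths of the Hamiltonian `H = ħ Σ_i h_i σ_z^i`:
`F_ii = 4(1 − E_ψ[Z_i]²)` and `F_ij = 4(E_ψ[Z_i Z_j] − E_ψ[Z_i] E_ψ[Z_j])` for `i ≠ j`. -/
noncomputable def qfim {N : ℕ} (ψ : (Fin N → Fin 2) → ℂ) : Matrix (Fin N) (Fin N) ℝ :=
  Matrix.of fun i j =>
    if i = j then 4 * (1 - expZ ψ i ^ 2)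
    else 4 * (expZZ ψ i j - expZ ψ i * expZ ψ j)

/-- The weight matrix `W̄ = a·I + b·(J − I)` with `a = 16[(N−1)α² + 1]`,
`b = 16[(N−2)α² + 2α]`, `J` the all-ones matrix. -/
noncomputable def weightW (N : ℕ) (α : ℝ) : Matrix (Fin N) (Fin N) ℝ :=
  (16 * (((N : ℝ) - 1) * α ^ 2 + 1)) • (1 : Matrix (Fin N) (Fin N) ℝ)
    + (16 * (((N : ℝ) - 2) * α ^ 2 + 2 * α)) •
        ((Matrix.of fun _ _ => (1 : ℝ)) - (1 : Matrix (Fin N) (Fin N) ℝ))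

/-- Flip the `i`-th bit of a basis label. -/
def flipBit {N : ℕ} (i : Fin N) (x : Fin N → Fin 2) : Fin N → Fin 2 :=
  Function.update x i (1 - x i)

lemma flipBit_flipBit {N : ℕ} (i : Fin N) (x : Fin N → Fin 2) :
    flipBit i (flipBit i x) = x := by
  simp [flipBit]

lemma qubitSign_flipBit_self {N : ℕ} (i : Fin N) (x : Fin N → Fin 2) :
    qubitSign (flipBit i x i) = -qubitSign (x i) := by
  simp only [flipBit, Function.update_self]
  generalize x i = b
  fin_cases b <;> simp [qubitSign]

lemma qubitSign_flipBit_of_ne {N : ℕ} {i j : Fin N} (h : j ≠ i) (x : Fin N → Fin 2) :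
    qubitSign (flipBit i x j) = qubitSign (x j) := by
  simp [flipBit, h]

/-- A function that is odd under flipping the `i`-th bit sums to zero. -/
lemma sum_eq_zero_of_flipBit_neg {N : ℕ} (i : Fin N) (f : (Fin N → Fin 2) → ℝ)
    (hf : ∀ x, f (flipBit i x) = -f x) : ∑ x, f x = 0 := by
  have h : ∑ x, f (flipBit i x) = ∑ x, f x :=
    Equiv.sum_comp (Function.Involutive.toPerm _ (flipBit_flipBit i)) f
  simp only [hf, Finset.sum_neg_distrib] at h
  linarith

section UniformWeight

variable {N : ℕ} {ψ : (Fin N → Fin 2) → ℂ} {c : ℝ}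

lemma expZ_eq_zero_of_uniform (hψ : ∀ x, ‖ψ x‖ ^ 2 = c) (i : Fin N) : expZ ψ i = 0 :=
  sum_eq_zero_of_flipBit_neg i _ fun x => by
    rw [qubitSign_flipBit_self, hψ, hψ, neg_mul]

lemma expZZ_eq_zero_of_uniform (hψ : ∀ x, ‖ψ x‖ ^ 2 = c) {i j : Fin N} (hij : i ≠ j) :
    expZZ ψ i j = 0 :=
  sum_eq_zero_of_flipBit_neg i _ fun x => by
    rw [qubitSign_flipBit_self, qubitSign_flipBit_of_ne hij.symm, hψ, hψ, neg_mul, neg_mul]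

lemma qfim_eq_of_uniform (hψ : ∀ x, ‖ψ x‖ ^ 2 = c) :
    qfim ψ = (4 : ℝ) • (1 : Matrix (Fin N) (Fin N) ℝ) := by
  ext i j
  by_cases hij : i = j
  · simp [qfim, hij, expZ_eq_zero_of_uniform hψ]
  · simp [qfim, hij, expZ_eq_zero_of_uniform hψ, expZZ_eq_zero_of_uniform hψ hij]

end UniformWeight

lemma norm_sq_prod_of_equal_weight {N : ℕ} {φ : Fin N → Fin 2 → ℂ}
    (hφ0 : ∀ i, ‖φ i 0‖ ^ 2 = 1 / 2) (hφ1 : ∀ i, ‖φ i 1‖ ^ 2 = 1 / 2) (x : Fin N → Fin 2) :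
    ‖∏ i, φ i (x i)‖ ^ 2 = (1 / 2) ^ N := by
  have h : ∀ i b, ‖φ i b‖ ^ 2 = 1 / 2 := fun i => Fin.forall_fin_two.2 ⟨hφ0 i, hφ1 i⟩
  simp only [norm_prod, ← Finset.prod_pow, h, Finset.prod_const, Finset.card_univ,
    Fintype.card_fin]

lemma trace_weightW (N : ℕ) (α : ℝ) :
    (weightW N α).trace = (N : ℝ) * (16 * (((N : ℝ) - 1) * α ^ 2 + 1)) := by
  simp [weightW, Matrix.trace]

/-- Corollary 2: a fully product `N`-qubit pure state whose single-qubit factors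
are equal-weight superpositions (`|φ_i(0)|² = |φ_i(1)|² = 1/2`) satisfies
`E_ψ[Z_i] = 0` for all `i`, has QFIM `F(ψ) = 4·I`, and attains
`Tr(W̄ F(ψ)⁻¹) = N a/4 = 4N[(N−1)α² + 1]`, the optimum over pure product probes. -/
theorem equal_superposition_product_probe_optimal
    {N : ℕ} (hN : 1 ≤ N) (α : ℝ) (hα0 : 0 < α) (hα1 : α < 1)
    (φ : Fin N → Fin 2 → ℂ)
    (hφ0 : ∀ i, ‖φ i 0‖ ^ 2 = 1 / 2) (hφ1 : ∀ i, ‖φ i 1‖ ^ 2 = 1 / 2)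
    (ψ : (Fin N → Fin 2) → ℂ)
    (hψdef : ∀ x : Fin N → Fin 2, ψ x = ∏ i, φ i (x i)) :
    (∀ i, expZ ψ i = 0) ∧
    qfim ψ = (4 : ℝ) • (1 : Matrix (Fin N) (Fin N) ℝ) ∧
    Matrix.trace (weightW N α * (qfim ψ)⁻¹)
        = (N : ℝ) * (16 * (((N : ℝ) - 1) * α ^ 2 + 1)) / 4 ∧
    Matrix.trace (weightW N α * (qfim ψ)⁻¹)
        = 4 * (N : ℝ) * (((N : ℝ) - 1) * α ^ 2 + 1) := by
  have hψ : ∀ x, ‖ψ x‖ ^ 2 = (1 / 2) ^ N := fun x => by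
    rw [hψdef, norm_sq_prod_of_equal_weight hφ0 hφ1]
  have hF := qfim_eq_of_uniform hψ
  have hinv : (qfim ψ)⁻¹ = (1 / 4 : ℝ) • (1 : Matrix (Fin N) (Fin N) ℝ) := by
    rw [hF]
    exact Matrix.inv_eq_right_inv (by simp [smul_smul])
  have htr : Matrix.trace (weightW N α * (qfim ψ)⁻¹)
      = (N : ℝ) * (16 * (((N : ℝ) - 1) * α ^ 2 + 1)) / 4 := by
    rw [hinv, Matrix.mul_smul, Matrix.mul_one, Matrix.trace_smul, trace_weightW, smul_eq_mul]
    ring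
  exact ⟨expZ_eq_zero_of_uniform hψ, hF, htr, htr.trans (by ring)⟩
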